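/- Let H be an infinite-dimensional complex Hilbert space and let u be the free pluriharmonic function with scalar coefficients (a, b) on the unit ball (γ = 1). Then the following are equivalent: (i) there exists a function ũ : [B(H)ⁿ]₁⁻ → B(H), continuous with respect to the operator norm topologies, such that ũ(X) = u_H(X) for every X ∈ [B(H)ⁿ]₁; (ii) the limit lim_{r→1⁻} u_{F²}(rS₁,…,rSₙ) exists in the operator norm of B(F²(Hₙ)), where u_{F²}(rS₁,…,rSₙ) = Σ_{k=1}^∞ Σ_{|α|=k} b_α r^k S_α* + a_{g₀} I + Σ_{k=1}^∞ Σ_{|α|=k} a_α r^k S_α. -/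

import Mathlib

open scoped ENNReal ComplexOrder
open Filter ContinuousLinearMap

noncomputable section

abbrev Word (n : ℕ) := FreeMonoid (Fin n)

/-- The word determined by a tuple of letters. -/
def word {n k : ℕ} (f : Fin k → Fin n) : Word n :=
  FreeMonoid.ofList (List.ofFn f)

/-- The length of a word. -/
def wordLen {n : ℕ} (α : Word n) : ℕ := (FreeMonoid.toList α).length

/-- The product `X_α = X_{i₁} ⋯ X_{i_k}` for `α = g_{i₁} ⋯ g_{i_k}`. -/
def wordProd {n : ℕ} {K : Type} [NormedAddCommGroup K] [InnerProductSpace ℂ K]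
    (X : Fin n → K →L[ℂ] K) (α : Word n) : K →L[ℂ] K :=
  ((FreeMonoid.toList α).map X).prod

/-- `Σ_{|α| = k} a_α X_α`. -/
def truncSum {n : ℕ} {K : Type} [NormedAddCommGroup K] [InnerProductSpace ℂ K]
    (a : Word n → ℂ) (X : Fin n → K →L[ℂ] K) (k : ℕ) : K →L[ℂ] K :=
  ∑ f : Fin k → Fin n, a (word f) • wordProd X (word f)

/-- `Σ_{|α| = k} b_α X_α*`. -/
def truncSumAdj {n : ℕ} {K : Type} [NormedAddCommGroup K] [InnerProductSpace ℂ K]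
    [CompleteSpace K] (b : Word n → ℂ) (X : Fin n → K →L[ℂ] K) (k : ℕ) : K →L[ℂ] K :=
  ∑ f : Fin k → Fin n, b (word f) • adjoint (wordProd X (word f))

/-- The free holomorphic function `f(X) = Σ_k Σ_{|α| = k} a_α X_α`. -/
def holOp {n : ℕ} {K : Type} [NormedAddCommGroup K] [InnerProductSpace ℂ K]
    (a : Word n → ℂ) (X : Fin n → K →L[ℂ] K) : K →L[ℂ] K :=
  ∑' k : ℕ, truncSum a X k

/-- The free pluriharmonic function
`u(X) = Σ_{k ≥ 1} Σ_{|α| = k} b_α X_α* + a_{g₀} I + Σ_{k ≥ 1} Σ_{|α| = k} a_α X_α`. -/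
def phOp {n : ℕ} {K : Type} [NormedAddCommGroup K] [InnerProductSpace ℂ K]
    [CompleteSpace K] (a b : Word n → ℂ) (X : Fin n → K →L[ℂ] K) : K →L[ℂ] K :=
  (∑' k : ℕ, truncSumAdj b X (k + 1)) + a 1 • (1 : K →L[ℂ] K)
    + ∑' k : ℕ, truncSum a X (k + 1)

/-- Membership in the open noncommutative ball of radius `γ`. -/
def inBall {n : ℕ} {K : Type} [NormedAddCommGroup K] [InnerProductSpace ℂ K]
    [CompleteSpace K] (γ : ℝ) (X : Fin n → K →L[ℂ] K) : Prop :=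
  ‖∑ i, X i * adjoint (X i)‖ < γ ^ 2

/-- Membership in the closed noncommutative ball of radius `γ`. -/
def inClosedBall {n : ℕ} {K : Type} [NormedAddCommGroup K] [InnerProductSpace ℂ K]
    [CompleteSpace K] (γ : ℝ) (X : Fin n → K →L[ℂ] K) : Prop :=
  ‖∑ i, X i * adjoint (X i)‖ ≤ γ ^ 2

/-- The radius-`γ` condition `limsup_k (Σ_{|α|=k} |a_α|²)^{1/(2k)} ≤ 1/γ`. -/
def radCond {n : ℕ} (γ : ℝ) (a : Word n → ℂ) : Prop :=
  Filter.limsup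
    (fun k : ℕ =>
      (∑ f : Fin k → Fin n, (‖a (word f)‖₊ : ℝ≥0∞) ^ 2) ^ ((1 : ℝ) / (2 * (k : ℝ))))
    Filter.atTop ≤ ENNReal.ofReal (1 / γ)

/-- The coefficients of the radial function: `α ↦ r^{|α|} a_α`. -/
def scaleCoef {n : ℕ} (r : ℝ) (a : Word n → ℂ) : Word n → ℂ :=
  fun α => ((r : ℂ) ^ wordLen α) * a α

/-- Positivity of the free pluriharmonic function with coefficients `(a, b)` on the
noncommutative ball of radius `γ` of every complex Hilbert space. -/
def posPH {n : ℕ} (γ : ℝ) (a b : Word n → ℂ) : Prop :=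
  ∀ (K : Type) [NormedAddCommGroup K] [InnerProductSpace ℂ K] [CompleteSpace K],
    ∀ X : Fin n → K →L[ℂ] K, inBall γ X → (phOp a b X).IsPositive


section aux

variable {n : ℕ}

lemma word_cons {k : ℕ} (i : Fin n) (f : Fin k → Fin n) :
    word (Fin.cons i f : Fin (k+1) → Fin n) = FreeMonoid.of i * word f := by
  unfold word
  rw [List.ofFn_succ]
  simp only [Fin.cons_zero, Fin.cons_succ]
  rfl

lemma word_zero (f : Fin 0 → Fin n) : word f = 1 := by
  unfold word
  simp

lemma wordLen_word {k : ℕ} (f : Fin k → Fin n) : wordLen (word f) = k := by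
  unfold wordLen word
  simp

lemma sum_cons {M : Type*} [AddCommMonoid M] (g : Word n → M) (k : ℕ) :
    ∑ f : Fin (k+1) → Fin n, g (word f) =
      ∑ i : Fin n, ∑ f : Fin k → Fin n, g (FreeMonoid.of i * word f) := by
  rw [← Fintype.sum_prod_type' (f := fun (i : Fin n) (f : Fin k → Fin n) => g (FreeMonoid.of i * word f))]
  rw [← (Fin.consEquiv (fun _ : Fin (k+1) => Fin n)).sum_comp]
  refine Finset.sum_congr rfl fun x _ => ?_
  rw [← word_cons]
  rfl

lemma sum_zero' {M : Type*} [AddCommMonoid M] (g : Word n → M) :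
    ∑ f : Fin 0 → Fin n, g (word f) = g 1 := by
  simp [word_zero]

lemma hasSum_word {g : Word n → ℝ} (hg : ∀ α, 0 ≤ g α) {s : ℝ}
    (h : HasSum (fun k : ℕ => ∑ f : Fin k → Fin n, g (word f)) s) : HasSum g s := by
  let E : List (Fin n) ≃ Σ k, Fin k → Fin n := List.equivSigmaTuple
  have h1 : Summable (fun x : Σ k, Fin k → Fin n => g (word x.2)) := by
    rw [summable_sigma_of_nonneg (fun x => hg _)]
    refine ⟨fun k => (hasSum_fintype _).summable, ?_⟩
    simpa [tsum_fintype] using h.summable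
  have h2 : HasSum (fun x : Σ k, Fin k → Fin n => g (word x.2)) s := by
    have := h1.hasSum.sigma (fun k => hasSum_fintype _)
    rw [← this.unique h]
    exact h1.hasSum
  have h3 := (E.hasSum_iff (f := fun x : Σ k, Fin k → Fin n => g (word x.2))).2 h2
  have h4 : g = ((fun x : Σ k, Fin k → Fin n => g (word x.2)) ∘ E) := by
    funext α
    have : word (E α).2 = α := E.symm_apply_apply α
    exact congrArg g this.symm
  rw [h4]
  exact h3

variable {K : Type} [NormedAddCommGroup K] [InnerProductSpace ℂ K]

lemma wordProd_one (X : Fin n → K →L[ℂ] K) : wordProd X 1 = 1 := by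
  simp [wordProd]

lemma wordProd_cons (X : Fin n → K →L[ℂ] K) (i : Fin n) (α : Word n) :
    wordProd X (FreeMonoid.of i * α) = X i * wordProd X α := by
  simp [wordProd]

lemma word_induction {p : Word n → Prop} (h1 : p 1)
    (h2 : ∀ i α, p α → p (FreeMonoid.of i * α)) (α : Word n) : p α :=
  FreeMonoid.inductionOn' α h1 h2

lemma wordProd_smul (X : Fin n → K →L[ℂ] K) (r : ℂ) (α : Word n) :
    wordProd (fun i => r • X i) α = r ^ wordLen α • wordProd X α := by
  induction α using word_induction with
  | h1 => simp [wordProd, wordLen]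
  | h2 i α ih =>
    rw [wordProd_cons, wordProd_cons, ih]
    have : wordLen (FreeMonoid.of i * α) = wordLen α + 1 := by simp [wordLen]
    rw [this, smul_mul_smul_comm, pow_succ']

variable [CompleteSpace K]

lemma re_inner_row (X : Fin n → K →L[ℂ] K) (h : K) :
    ∑ i, ‖adjoint (X i) h‖ ^ 2 = (inner ℂ ((∑ i, X i * adjoint (X i)) h) h : ℂ).re := by
  rw [_root_.sum_apply, sum_inner, Complex.re_sum]
  refine Finset.sum_congr rfl fun i _ => ?_
  rw [mul_apply_eq_comp, ← ContinuousLinearMap.adjoint_inner_right,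
    inner_self_eq_norm_sq_to_K]
  norm_cast

lemma row_bound (X : Fin n → K →L[ℂ] K) {q : ℝ} (hX : ‖∑ i, X i * adjoint (X i)‖ ≤ q) (h : K) :
    ∑ i, ‖adjoint (X i) h‖ ^ 2 ≤ q * ‖h‖ ^ 2 := by
  rw [re_inner_row]
  calc _ ≤ ‖(inner ℂ ((∑ i, X i * adjoint (X i)) h) h : ℂ)‖ := Complex.re_le_norm _
    _ ≤ ‖(∑ i, X i * adjoint (X i)) h‖ * ‖h‖ := norm_inner_le_norm _ _
    _ ≤ (‖(∑ i, X i * adjoint (X i))‖ * ‖h‖) * ‖h‖ := by gcongr; exact le_opNorm _ _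
    _ ≤ (q * ‖h‖) * ‖h‖ := by gcongr
    _ = _ := by ring

lemma adj_cons (X : Fin n → K →L[ℂ] K) (i : Fin n) (α : Word n) (h : K) :
    adjoint (wordProd X (FreeMonoid.of i * α)) h = adjoint (wordProd X α) (adjoint (X i) h) := by
  rw [wordProd_cons, ContinuousLinearMap.mul_def, ContinuousLinearMap.adjoint_comp]
  rfl

lemma level_bound (X : Fin n → K →L[ℂ] K) {q : ℝ} (hq : 0 ≤ q)
    (hX : ∀ h, ∑ i, ‖adjoint (X i) h‖ ^ 2 ≤ q * ‖h‖ ^ 2) (k : ℕ) (h : K) :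
    ∑ f : Fin k → Fin n, ‖adjoint (wordProd X (word f)) h‖ ^ 2 ≤ q ^ k * ‖h‖ ^ 2 := by
  induction k generalizing h with
  | zero =>
    rw [sum_zero' (fun α => ‖adjoint (wordProd X α) h‖ ^ 2), wordProd_one]
    rw [show (1 : K →L[ℂ] K) = ContinuousLinearMap.id ℂ K from rfl, ContinuousLinearMap.adjoint_id]
    simp
  | succ k ih =>
    rw [sum_cons (fun α => ‖adjoint (wordProd X α) h‖ ^ 2)]
    simp only [adj_cons]
    calc _ ≤ ∑ i, q ^ k * ‖adjoint (X i) h‖ ^ 2 := Finset.sum_le_sum fun i _ => ih _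
      _ = q ^ k * ∑ i, ‖adjoint (X i) h‖ ^ 2 := by rw [Finset.mul_sum]
      _ ≤ q ^ k * (q * ‖h‖ ^ 2) := by gcongr; exact hX h
      _ = _ := by ring

/-- level coefficient norm -/
def lev (a : Word n → ℂ) (k : ℕ) : ℝ := √(∑ f : Fin k → Fin n, ‖a (word f)‖ ^ 2)

lemma lev_nonneg (a : Word n → ℂ) (k : ℕ) : 0 ≤ lev a k := Real.sqrt_nonneg _

lemma norm_truncSumAdj_le (X : Fin n → K →L[ℂ] K) (hX : inClosedBall 1 X) (b : Word n → ℂ) (k : ℕ) :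
    ‖truncSumAdj b X k‖ ≤ lev b k := by
  refine ContinuousLinearMap.opNorm_le_bound _ (lev_nonneg _ _) fun h => ?_
  have h0 : ∀ h, ∑ i, ‖adjoint (X i) h‖ ^ 2 ≤ 1 * ‖h‖ ^ 2 :=
    row_bound X (by simpa [inClosedBall] using hX)
  have h1 := level_bound X zero_le_one h0 k h
  unfold truncSumAdj
  rw [_root_.sum_apply]
  calc _ ≤ ∑ f : Fin k → Fin n, ‖b (word f)‖ * ‖adjoint (wordProd X (word f)) h‖ := by
        refine (norm_sum_le _ _).trans (Finset.sum_le_sum fun f _ => ?_)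
        rw [_root_.smul_apply, norm_smul]
    _ ≤ √(∑ f : Fin k → Fin n, ‖b (word f)‖ ^ 2) *
        √(∑ f : Fin k → Fin n, ‖adjoint (wordProd X (word f)) h‖ ^ 2) :=
        Real.sum_mul_le_sqrt_mul_sqrt _ _ _
    _ ≤ lev b k * ‖h‖ := by
        unfold lev
        gcongr
        rw [Real.sqrt_le_left (norm_nonneg _)]
        simpa using h1

lemma norm_truncSum_le (X : Fin n → K →L[ℂ] K) (hX : inClosedBall 1 X) (b : Word n → ℂ) (k : ℕ) :
    ‖truncSum b X k‖ ≤ lev b k := by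
  have : truncSum b X k = adjoint (truncSumAdj (fun α => star (b α)) X k) := by
    unfold truncSum truncSumAdj
    rw [map_sum]
    refine Finset.sum_congr rfl fun f _ => ?_
    rw [LinearIsometryEquiv.map_smulₛₗ, ContinuousLinearMap.adjoint_adjoint]
    simp
  rw [this, LinearIsometryEquiv.norm_map]
  refine (norm_truncSumAdj_le X hX _ k).trans (le_of_eq ?_)
  simp [lev]

def good (a : Word n → ℂ) : Prop := Summable (lev a)

lemma truncSum_summable (X : Fin n → K →L[ℂ] K) (hX : inClosedBall 1 X) {a : Word n → ℂ}
    (ha : good a) : Summable (fun k => truncSum a X (k+1)) :=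
  Summable.of_norm_bounded ((summable_nat_add_iff 1).2 ha) fun k => norm_truncSum_le X hX a (k+1)

lemma truncSumAdj_summable (X : Fin n → K →L[ℂ] K) (hX : inClosedBall 1 X) {a : Word n → ℂ}
    (ha : good a) : Summable (fun k => truncSumAdj a X (k+1)) :=
  Summable.of_norm_bounded ((summable_nat_add_iff 1).2 ha) fun k => norm_truncSumAdj_le X hX a (k+1)

lemma continuous_wordProd (α : Word n) :
    Continuous (fun X : Fin n → K →L[ℂ] K => wordProd X α) := by
  induction α using word_induction with
  | h1 => simp only [wordProd_one]; exact continuous_const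
  | h2 i α ih =>
    simp only [wordProd_cons]
    exact (continuous_apply i).mul ih

lemma continuousOn_phOp {a b : Word n → ℂ} (ha : good a) (hb : good b) :
    ContinuousOn (fun X : Fin n → K →L[ℂ] K => phOp a b X) {X | inClosedBall 1 X} := by
  unfold phOp
  refine ((continuousOn_tsum (u := fun k => lev b (k+1)) ?_ ((summable_nat_add_iff 1).2 hb) ?_).add
    continuousOn_const).add
    (continuousOn_tsum (u := fun k => lev a (k+1)) ?_ ((summable_nat_add_iff 1).2 ha) ?_)
  · intro k
    unfold truncSumAdj
    refine Continuous.continuousOn (continuous_finsetSum _ fun f _ => ?_)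
    exact Continuous.fun_const_smul (((ContinuousLinearMap.adjoint (𝕜 := ℂ) (E := K) (F := K)).continuous).comp
      (continuous_wordProd _)) (b (word f))
  · intro k X hX
    exact norm_truncSumAdj_le X hX _ _
  · intro k
    unfold truncSum
    refine Continuous.continuousOn (continuous_finsetSum _ fun f _ => ?_)
    exact Continuous.fun_const_smul (continuous_wordProd _) (a (word f))
  · intro k X hX
    exact norm_truncSum_le X hX _ _

lemma phOp_scale (a b : Word n → ℂ) (r : ℝ) (X : Fin n → K →L[ℂ] K) :
    phOp (scaleCoef r a) (scaleCoef r b) X = phOp a b (fun i => (r : ℂ) • X i) := by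
  unfold phOp
  congr 1
  · congr 1
    · congr 1
      funext k
      unfold truncSumAdj
      refine Finset.sum_congr rfl fun f _ => ?_
      rw [wordProd_smul, LinearIsometryEquiv.map_smulₛₗ, smul_smul]
      simp [scaleCoef, mul_comm]
    · simp [scaleCoef, wordLen]
  · congr 1
    funext k
    unfold truncSum
    refine Finset.sum_congr rfl fun f _ => ?_
    rw [wordProd_smul, smul_smul]
    simp [scaleCoef, mul_comm]

lemma norm_row_smul (r : ℝ) (X : Fin n → K →L[ℂ] K) :
    ‖∑ i, ((r : ℂ) • X i) * adjoint ((r : ℂ) • X i)‖ = r ^ 2 * ‖∑ i, X i * adjoint (X i)‖ := by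
  have : ∑ i, ((r : ℂ) • X i) * adjoint ((r : ℂ) • X i)
      = ((r : ℂ) ^ 2) • ∑ i, X i * adjoint (X i) := by
    rw [Finset.smul_sum]
    refine Finset.sum_congr rfl fun i _ => ?_
    rw [LinearIsometryEquiv.map_smulₛₗ, smul_mul_smul_comm]
    simp [sq]
  rw [this, norm_smul]
  simp

lemma good_scale {a : Word n → ℂ} (ha : radCond 1 a) {r : ℝ} (h0 : 0 ≤ r) (h1 : r < 1) :
    good (scaleCoef r a) := by
  have hl : ∀ k, lev (scaleCoef r a) k = r ^ k * lev a k := by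
    intro k
    unfold lev
    rw [← Real.sqrt_sq (pow_nonneg h0 k), ← Real.sqrt_mul (by positivity), Finset.mul_sum]
    congr 1
    refine Finset.sum_congr rfl fun f _ => ?_
    simp [scaleCoef, wordLen_word, mul_pow, abs_of_nonneg h0]
  obtain ⟨t, ht1, ht2⟩ : ∃ t : ℝ, 1 < t ∧ t * r < 1 := by
    refine ⟨2 / (1 + r), ?_, ?_⟩
    · rw [lt_div_iff₀ (by linarith)]; linarith
    · rw [div_mul_eq_mul_div, div_lt_one (by linarith)]; linarith
  have hlim : Filter.limsup
    (fun k : ℕ =>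
      (∑ f : Fin k → Fin n, (‖a (word f)‖₊ : ℝ≥0∞) ^ 2) ^ ((1 : ℝ) / (2 * (k : ℝ))))
    Filter.atTop < ENNReal.ofReal t := by
    refine lt_of_le_of_lt ha ?_
    rw [ENNReal.ofReal_lt_ofReal_iff (by linarith)]
    simpa using ht1
  have hev := eventually_lt_of_limsup_lt hlim
  have hev2 : ∀ᶠ k : ℕ in atTop, lev a k ≤ t ^ k := by
    filter_upwards [hev, eventually_gt_atTop 0] with k hk hk0
    have hk' : (0 : ℝ) < 2 * k := by positivity
    have e1 : (∑ f : Fin k → Fin n, (‖a (word f)‖₊ : ℝ≥0∞) ^ 2)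
        = ENNReal.ofReal (∑ f : Fin k → Fin n, ‖a (word f)‖ ^ 2) := by
      rw [ENNReal.ofReal_sum_of_nonneg (fun _ _ => by positivity)]
      refine Finset.sum_congr rfl fun f _ => ?_
      rw [ENNReal.ofReal_pow (norm_nonneg _), ofReal_norm]
      rfl
    rw [e1, ENNReal.ofReal_rpow_of_nonneg (by positivity) (by positivity),
      ENNReal.ofReal_lt_ofReal_iff (by linarith)] at hk
    unfold lev
    rw [Real.sqrt_le_left (by positivity)]
    have hs : (0:ℝ) ≤ ∑ f : Fin k → Fin n, ‖a (word f)‖ ^ 2 := by positivity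
    calc _ = ((∑ f : Fin k → Fin n, ‖a (word f)‖ ^ 2) ^ ((1 : ℝ) / (2 * (k : ℝ)))) ^ (2 * (k:ℝ)) := by
          rw [← Real.rpow_mul hs, one_div_mul_cancel hk'.ne', Real.rpow_one]
      _ ≤ t ^ (2 * (k : ℝ)) := by gcongr
      _ = (t ^ k) ^ 2 := by
          rw [← pow_mul, ← Real.rpow_natCast]; push_cast; ring_nf
  unfold good
  refine Summable.of_norm_bounded_eventually_nat (g := fun k => (t * r) ^ k)
    (summable_geometric_of_lt_one (by positivity) ht2) ?_
  filter_upwards [hev2] with k hk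
  rw [Real.norm_of_nonneg (lev_nonneg _ _), hl, mul_pow, mul_comm]
  gcongr

lemma map_phOp {K' : Type} [NormedAddCommGroup K'] [InnerProductSpace ℂ K'] [CompleteSpace K']
    {X : Fin n → K →L[ℂ] K} {Y : Fin n → K' →L[ℂ] K'} (hX : inClosedBall 1 X)
    {a b : Word n → ℂ} (ha : good a) (hb : good b)
    (φ : (K →L[ℂ] K) →L[ℂ] (K' →L[ℂ] K'))
    (h1 : ∀ α, φ (wordProd X α) = wordProd Y α)
    (h2 : ∀ α, φ (adjoint (wordProd X α)) = adjoint (wordProd Y α)) :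
    φ (phOp a b X) = phOp a b Y := by
  unfold phOp
  rw [map_add, map_add, map_smul, φ.map_tsum (truncSum_summable X hX ha),
    φ.map_tsum (truncSumAdj_summable X hX hb)]
  have := h1 1
  rw [wordProd_one, wordProd_one] at this
  rw [this]
  simp only [truncSum, truncSumAdj, map_sum, map_smul, h1, h2]

end aux

section aux2

variable {n : ℕ}
variable {F : Type} [NormedAddCommGroup F] [InnerProductSpace ℂ F] [CompleteSpace F]

lemma hb_ext (e : HilbertBasis (Word n) ℂ F) {x y : F}
    (h : ∀ α, inner ℂ (e α) x = inner ℂ (e α) y) : x = y := by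
  apply e.repr.injective
  ext α
  simpa [e.repr_apply_apply] using h α

lemma S_inClosedBall (e : HilbertBasis (Word n) ℂ F) (S : Fin n → F →L[ℂ] F)
    (hS : ∀ (i : Fin n) (α : Word n), S i (e α) = e (FreeMonoid.of i * α)) :
    inClosedBall 1 S := by
  classical
  have h1 : ∀ i j, adjoint (S i) * S j = if i = j then 1 else 0 := by
    intro i j
    have h2 : ∀ β, adjoint (S i) (S j (e β)) = (if i = j then (1 : F →L[ℂ] F) else 0) (e β) := by
      intro β
      apply hb_ext e
      intro α
      rw [ContinuousLinearMap.adjoint_inner_right, hS, hS]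
      have ho := orthonormal_iff_ite.1 e.orthonormal
      rw [ho]
      by_cases hij : i = j
      · subst hij
        have hc : FreeMonoid.of i * α = FreeMonoid.of i * β ↔ α = β := by
          constructor
          · intro h
            have := congrArg FreeMonoid.toList h
            simpa using this
          · rintro rfl; rfl
        simp [ho, hc]
      · have : ¬ (FreeMonoid.of i * α = FreeMonoid.of j * β) := by
          intro h
          have := congrArg FreeMonoid.toList h
          simp at this
          exact hij this.1
        simp [hij, this]
    have hd : Dense ((Submodule.span ℂ (Set.range e) : Submodule ℂ F) : Set F) := by
      rw [Submodule.dense_iff_topologicalClosure_eq_top]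
      exact e.dense_span
    refine ContinuousLinearMap.ext_on hd ?_
    rintro _ ⟨β, rfl⟩
    exact h2 β
  set P := ∑ i, S i * adjoint (S i) with hP
  have hPP : P * P = P := by
    rw [hP, Finset.sum_mul_sum]
    refine Finset.sum_congr rfl fun i _ => ?_
    have : ∀ j, S i * adjoint (S i) * (S j * adjoint (S j)) =
        if i = j then S i * adjoint (S i) else 0 := by
      intro j
      calc _ = S i * (adjoint (S i) * S j) * adjoint (S j) := by simp only [mul_assoc]
        _ = _ := by
          rw [h1]
          split_ifs with h
          · subst h; simp
          · simp
    simp [this]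
  have hPs : star P = P := by
    rw [hP, star_sum]
    refine Finset.sum_congr rfl fun i _ => ?_
    rw [star_mul, ← ContinuousLinearMap.star_eq_adjoint, star_star]
  have hn : ‖P‖ * ‖P‖ = ‖P‖ := by
    rw [← CStarRing.norm_star_mul_self, hPs, hPP]
  unfold inClosedBall
  rw [← hP]
  nlinarith [norm_nonneg P]

variable {K : Type} [NormedAddCommGroup K] [InnerProductSpace ℂ K] [CompleteSpace K]

lemma exists_defect (X : Fin n → K →L[ℂ] K) (hX : ∀ h, ∑ i, ‖adjoint (X i) h‖ ^ 2 ≤ ‖h‖ ^ 2) :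
    ∃ D : K →L[ℂ] K, ∀ h, ‖D h‖ ^ 2 = ‖h‖ ^ 2 - ∑ i, ‖adjoint (X i) h‖ ^ 2 := by
  set Q : K →L[ℂ] K := 1 - ∑ i, X i * adjoint (X i) with hQ
  have hre : ∀ h, (inner ℂ (Q h) h : ℂ).re = ‖h‖ ^ 2 - ∑ i, ‖adjoint (X i) h‖ ^ 2 := by
    intro h
    rw [re_inner_row, hQ, _root_.sub_apply, inner_sub_left, Complex.sub_re]
    congr 1
    rw [one_apply_eq_self, inner_self_eq_norm_sq_to_K]
    norm_cast
  have hsa : IsSelfAdjoint Q := by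
    refine IsSelfAdjoint.sub (IsSelfAdjoint.one _) ?_
    refine isSelfAdjoint_sum _ fun i _ => ?_
    exact IsSelfAdjoint.mul_star_self (X i)
  have hpos : 0 ≤ Q := by
    rw [ContinuousLinearMap.nonneg_iff_isPositive, ContinuousLinearMap.isPositive_def']
    refine ⟨hsa, fun h => ?_⟩
    have := hre h
    rw [ContinuousLinearMap.reApplyInnerSelf_apply]
    change 0 ≤ (inner ℂ (Q h) h : ℂ).re
    rw [hre]
    linarith [hX h]
  refine ⟨CFC.sqrt Q, fun h => ?_⟩
  have h1 : CFC.sqrt Q * CFC.sqrt Q = Q := CFC.sqrt_mul_sqrt_self Q hpos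
  have h2 : adjoint (CFC.sqrt Q) = CFC.sqrt Q := by
    have : IsSelfAdjoint (CFC.sqrt Q) := (CFC.sqrt_nonneg Q).isSelfAdjoint
    exact this
  rw [← hre]
  have h3 : Q h = adjoint (CFC.sqrt Q) (CFC.sqrt Q h) := by
    rw [h2, ← mul_apply_eq_comp, h1]
  rw [h3, ContinuousLinearMap.adjoint_inner_left, inner_self_eq_norm_sq_to_K]
  norm_cast

lemma hasSum_defect (X : Fin n → K →L[ℂ] K) {q : ℝ} (hq : 0 ≤ q) (hq1 : q < 1)
    (hX : ∀ h, ∑ i, ‖adjoint (X i) h‖ ^ 2 ≤ q * ‖h‖ ^ 2)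
    (D : K →L[ℂ] K) (hD : ∀ h, ‖D h‖ ^ 2 = ‖h‖ ^ 2 - ∑ i, ‖adjoint (X i) h‖ ^ 2) (h : K) :
    HasSum (fun α : Word n => ‖D (adjoint (wordProd X α) h)‖ ^ 2) (‖h‖ ^ 2) := by
  have h0 : ∀ h, adjoint (wordProd X 1) h = h := by
    intro h
    rw [wordProd_one]
    rw [show (1 : K →L[ℂ] K) = ContinuousLinearMap.id ℂ K from rfl, ContinuousLinearMap.adjoint_id]
    simp
  have key : ∀ (k : ℕ) (h : K), ∑ f : Fin k → Fin n, ‖D (adjoint (wordProd X (word f)) h)‖ ^ 2 =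
      ∑ f : Fin k → Fin n, ‖adjoint (wordProd X (word f)) h‖ ^ 2 -
      ∑ f : Fin (k+1) → Fin n, ‖adjoint (wordProd X (word f)) h‖ ^ 2 := by
    intro k
    induction k with
    | zero =>
      intro h
      rw [sum_zero' (fun α => ‖adjoint (wordProd X α) h‖ ^ 2),
        sum_zero' (fun α => ‖D (adjoint (wordProd X α) h)‖ ^ 2),
        sum_cons (fun α => ‖adjoint (wordProd X α) h‖ ^ 2)]
      simp only [adj_cons]
      have : ∀ i, ∑ f : Fin 0 → Fin n, ‖adjoint (wordProd X (word f)) (adjoint (X i) h)‖ ^ 2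
          = ‖adjoint (X i) h‖ ^ 2 := by
        intro i
        rw [sum_zero' (fun α => ‖adjoint (wordProd X α) (adjoint (X i) h)‖ ^ 2), h0]
      simp only [this, h0]
      exact hD h
    | succ k ih =>
      intro h
      rw [sum_cons (fun α => ‖adjoint (wordProd X α) h‖ ^ 2) (k+1),
        sum_cons (fun α => ‖adjoint (wordProd X α) h‖ ^ 2) k,
        sum_cons (fun α => ‖D (adjoint (wordProd X α) h)‖ ^ 2)]
      simp only [adj_cons, ih, Finset.sum_sub_distrib]
  refine hasSum_word (fun α => by positivity) ?_
  simp only [key]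
  set N : ℕ → ℝ := fun k => ∑ f : Fin k → Fin n, ‖adjoint (wordProd X (word f)) h‖ ^ 2 with hN
  have hN0 : N 0 = ‖h‖ ^ 2 := by
    simp only [hN]
    rw [sum_zero' (fun α => ‖adjoint (wordProd X α) h‖ ^ 2), h0]
  have hlim : Tendsto N atTop (nhds 0) := by
    refine squeeze_zero (fun k => by positivity) (fun k => level_bound X hq hX k h) ?_
    simpa using (tendsto_pow_atTop_nhds_zero_of_lt_one hq hq1).mul_const (‖h‖ ^ 2)
  change HasSum (fun k => N k - N (k+1)) (‖h‖ ^ 2)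
  rw [hasSum_iff_tendsto_nat_of_nonneg]
  · have : ∀ m, ∑ i ∈ Finset.range m, (N i - N (i+1)) = N 0 - N m := fun m =>
      Finset.sum_range_sub' N m
    simp only [this, hN0]
    simpa using (tendsto_const_nhds (x := ‖h‖ ^ 2)).sub hlim
  · intro k
    have := key k h
    simp only [hN]
    rw [← this]
    positivity

lemma hb_parseval {J : Type} (f : HilbertBasis J ℂ K) (x : K) :
    HasSum (fun j => ‖(inner ℂ (f j) x : ℂ)‖ ^ 2) (‖x‖ ^ 2) := by
  have := lp.hasSum_norm (p := 2) (by norm_num) (f.repr x)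
  simpa [f.repr_apply_apply] using this

lemma exists_poisson (e : HilbertBasis (Word n) ℂ F) (S : Fin n → F →L[ℂ] F)
    (hS : ∀ (i : Fin n) (α : Word n), S i (e α) = e (FreeMonoid.of i * α))
    (X : Fin n → K →L[ℂ] K) {q : ℝ} (hq : 0 ≤ q) (hq1 : q < 1)
    (hX : ∀ h, ∑ i, ‖adjoint (X i) h‖ ^ 2 ≤ q * ‖h‖ ^ 2) :
    ∃ (J : Type) (W : K →ₗᵢ[ℂ] lp (fun _ : J => F) 2),
      ∀ i j h, W (adjoint (X i) h) j = adjoint (S i) (W h j) := by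
  obtain ⟨D, hD⟩ := exists_defect X (fun h => (hX h).trans
    (by nlinarith [sq_nonneg ‖h‖]))
  have hsum := hasSum_defect X hq hq1 hX D hD
  obtain ⟨w, f, -⟩ := exists_hilbertBasis ℂ K
  let c : w → K → Word n → ℂ := fun j h α => inner ℂ (f j) (D (adjoint (wordProd X α) h))
  have hdouble : ∀ h, HasSum (fun p : w × Word n => ‖c p.1 h p.2‖ ^ 2) (‖h‖ ^ 2) := by
    intro h
    have h1 : ∀ α, HasSum (fun j => ‖c j h α‖ ^ 2) (‖D (adjoint (wordProd X α) h)‖ ^ 2) :=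
      fun α => hb_parseval f _
    have h2 : Summable (fun p : Word n × w => ‖c p.2 h p.1‖ ^ 2) := by
      rw [summable_prod_of_nonneg (fun p => by positivity)]
      refine ⟨fun α => (h1 α).summable, ?_⟩
      simp only [(h1 _).tsum_eq]
      exact (hsum h).summable
    have h3 : HasSum (fun p : Word n × w => ‖c p.2 h p.1‖ ^ 2) (‖h‖ ^ 2) := by
      rw [← (h2.hasSum.prod_fiberwise h1).unique (hsum h)]
      exact h2.hasSum
    exact (Equiv.prodComm w (Word n)).hasSum_iff.2 h3
  have hcs : ∀ j h, Summable (fun α => ‖c j h α‖ ^ 2) := fun j h =>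
    ((summable_prod_of_nonneg (fun p => by positivity)).1 (hdouble h).summable).1 j
  have hmem : ∀ j h, Memℓp (c j h) 2 := fun j h =>
    memℓp_gen (by simpa using hcs j h)
  let C : w → K →ₗ[ℂ] F := fun j =>
    { toFun := fun h => e.repr.symm ⟨c j h, hmem j h⟩
      map_add' := by
        intro x y
        rw [← map_add]
        congr 1
        ext α
        simp only [c, map_add, inner_add_right]
        rfl
      map_smul' := by
        intro r x
        rw [RingHom.id_apply, ← map_smul]
        congr 1
        ext α
        simp only [c, map_smul, inner_smul_right]
        rfl }
  have hC : ∀ j h α, inner ℂ (e α) (C j h) = c j h α := by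
    intro j h α
    rw [← e.repr_apply_apply]
    simp [C]
  have hCn : ∀ j h, HasSum (fun α => ‖c j h α‖ ^ 2) (‖C j h‖ ^ 2) := by
    intro j h
    have := hb_parseval e (C j h)
    simpa only [hC] using this
  have hCsum : ∀ h, HasSum (fun j => ‖C j h‖ ^ 2) (‖h‖ ^ 2) := fun h =>
    (hdouble h).prod_fiberwise (fun j => hCn j h)
  have hmem2 : ∀ h, Memℓp (fun j => C j h) 2 := fun h =>
    memℓp_gen (by simpa using (hCsum h).summable)
  let W0 : K →ₗ[ℂ] lp (fun _ : w => F) 2 :=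
    { toFun := fun h => ⟨fun j => C j h, hmem2 h⟩
      map_add' := by
        intro x y
        ext j
        simp only [map_add, lp.coeFn_add, Pi.add_apply]
        try rfl
      map_smul' := by
        intro r x
        ext j
        simp }
  have hW0 : ∀ h j, W0 h j = C j h := fun h j => rfl
  have hnorm : ∀ h, ‖W0 h‖ = ‖h‖ := by
    intro h
    have h1 := lp.hasSum_norm (p := 2) (by norm_num) (W0 h)
    simp only [hW0] at h1
    have h2 : ‖W0 h‖ ^ 2 = ‖h‖ ^ 2 := by
      refine HasSum.unique ?_ (hCsum h)
      simpa using h1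
    exact (sq_eq_sq₀ (norm_nonneg _) (norm_nonneg _)).1 h2
  refine ⟨w, ⟨W0, hnorm⟩, fun i j h => ?_⟩
  change C j (adjoint (X i) h) = adjoint (S i) (C j h)
  apply hb_ext e
  intro α
  rw [ContinuousLinearMap.adjoint_inner_right, hS, hC, hC]
  simp only [c, adj_cons]

/-- Amplification of an operator. -/
def amp (J : Type) (T : F →L[ℂ] F) : lp (fun _ : J => F) 2 →L[ℂ] lp (fun _ : J => F) 2 :=
  LinearMap.mkContinuous
    { toFun := fun x => ⟨fun j => T (x j), by
        have h := (lp.hasSum_norm (p := 2) (by norm_num) x).summable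
        refine memℓp_gen (Summable.of_nonneg_of_le (fun j => by positivity) (fun j => ?_)
          (h.mul_left (‖T‖ ^ (2:ℝ≥0∞).toReal)))
        rw [← Real.mul_rpow (norm_nonneg _) (norm_nonneg _)]
        exact Real.rpow_le_rpow (norm_nonneg _) (le_opNorm _ _) (by norm_num)⟩
      map_add' := by
        intro x y
        ext j
        simp only [map_add, lp.coeFn_add, Pi.add_apply]
        try rfl
      map_smul' := by
        intro r x
        ext j
        simp } ‖T‖ (by
    intro x
    have h := (lp.hasSum_norm (p := 2) (by norm_num) x)
    refine lp.norm_le_of_tsum_le (by norm_num) (by positivity) ?_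
    rw [Real.mul_rpow (norm_nonneg _) (norm_nonneg _), ← h.tsum_eq, ← tsum_mul_left]
    have hle : ∀ j, ‖T (x j)‖ ^ (2:ℝ≥0∞).toReal ≤ ‖T‖ ^ (2:ℝ≥0∞).toReal * ‖x j‖ ^ (2:ℝ≥0∞).toReal := by
      intro j
      rw [← Real.mul_rpow (norm_nonneg _) (norm_nonneg _)]
      exact Real.rpow_le_rpow (norm_nonneg _) (le_opNorm _ _) (by norm_num)
    exact Summable.tsum_le_tsum hle (Summable.of_nonneg_of_le (fun j => by positivity) hle
      (h.summable.mul_left _)) (h.summable.mul_left _))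

lemma amp_apply (J : Type) (T : F →L[ℂ] F) (x : lp (fun _ : J => F) 2) (j : J) :
    amp J T x j = T (x j) := rfl

lemma amp_norm_le (J : Type) (T : F →L[ℂ] F) : ‖amp J T‖ ≤ ‖T‖ :=
  LinearMap.mkContinuous_norm_le _ (norm_nonneg _) _

lemma amp_inner (J : Type) (T : F →L[ℂ] F) (x y : lp (fun _ : J => F) 2) :
    inner ℂ (amp J (adjoint T) x) y = inner ℂ x (amp J T y) := by
  rw [lp.inner_eq_tsum, lp.inner_eq_tsum]
  simp only [amp_apply, ContinuousLinearMap.adjoint_inner_left]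

lemma amp_add (J : Type) (T T' : F →L[ℂ] F) : amp J (T + T') = amp J T + amp J T' := by
  ext x j
  rw [amp_apply, _root_.add_apply, _root_.add_apply, lp.coeFn_add, Pi.add_apply,
    amp_apply, amp_apply]

lemma amp_smul (J : Type) (r : ℂ) (T : F →L[ℂ] F) : amp J (r • T) = r • amp J T := by
  ext x j
  rw [amp_apply, _root_.smul_apply, _root_.smul_apply, lp.coeFn_smul, Pi.smul_apply,
    amp_apply]

lemma vN_abstract {G : Type} [NormedAddCommGroup G] [InnerProductSpace ℂ G] [CompleteSpace G]
    (S : Fin n → F →L[ℂ] F) (X : Fin n → K →L[ℂ] K)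
    (W : K →ₗᵢ[ℂ] G) (A : (F →L[ℂ] F) → (G →L[ℂ] G))
    (hadd : ∀ T T', A (T + T') = A T + A T') (hsmul : ∀ (r : ℂ) T, A (r • T) = r • A T)
    (hn : ∀ T, ‖A T‖ ≤ ‖T‖)
    (hin : ∀ T x y, inner ℂ (A (adjoint T) x) y = inner ℂ x (A T y))
    (hinter : ∀ α h, A (adjoint (wordProd S α)) (W h) = W (adjoint (wordProd X α) h)) :
    ∃ φ : (F →L[ℂ] F) →L[ℂ] (K →L[ℂ] K), (∀ T, ‖φ T‖ ≤ ‖T‖) ∧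
      (∀ α, φ (wordProd S α) = wordProd X α) ∧
      (∀ α, φ (adjoint (wordProd S α)) = adjoint (wordProd X α)) := by
  have hle : ∀ T : F →L[ℂ] F,
      ‖(adjoint W.toContinuousLinearMap).comp ((A T).comp W.toContinuousLinearMap)‖ ≤ ‖T‖ := by
    intro T
    have hW1 : ‖W.toContinuousLinearMap‖ ≤ 1 := W.norm_toContinuousLinearMap_le
    have hW2 : ‖adjoint W.toContinuousLinearMap‖ ≤ 1 := by
      rw [LinearIsometryEquiv.norm_map]; exact hW1
    calc _ ≤ ‖adjoint W.toContinuousLinearMap‖ * (‖A T‖ * ‖W.toContinuousLinearMap‖) :=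
          (opNorm_comp_le _ _).trans (by gcongr; exact opNorm_comp_le _ _)
      _ ≤ 1 * (‖T‖ * 1) := by
          gcongr
          exact hn T
      _ = ‖T‖ := by ring
  obtain ⟨φ, hφ⟩ : ∃ φ : (F →L[ℂ] F) →L[ℂ] (K →L[ℂ] K), ∀ T, φ T =
      (adjoint W.toContinuousLinearMap).comp ((A T).comp W.toContinuousLinearMap) :=
    ⟨LinearMap.mkContinuous
      { toFun := fun T =>
          (adjoint W.toContinuousLinearMap).comp ((A T).comp W.toContinuousLinearMap)
        map_add' := by
          intro T T'
          rw [hadd, ContinuousLinearMap.add_comp, ContinuousLinearMap.comp_add]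
        map_smul' := by
          intro r T
          rw [hsmul, ContinuousLinearMap.smul_comp, ContinuousLinearMap.comp_smul]
          rfl } 1 (by intro T; rw [one_mul]; exact hle T), fun T => rfl⟩
  have hφi : ∀ T h k, inner ℂ (φ T h) k = inner ℂ (A T (W h)) (W k) := by
    intro T h k
    rw [hφ, ContinuousLinearMap.comp_apply, ContinuousLinearMap.adjoint_inner_left]
    rfl
  have hadj : ∀ α, φ (adjoint (wordProd S α)) = adjoint (wordProd X α) := by
    intro α
    ext h
    refine ext_inner_right ℂ fun k => ?_
    rw [hφi, hinter, W.inner_map_map]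
  refine ⟨φ, fun T => by rw [hφ]; exact hle T, fun α => ?_, hadj⟩
  ext h
  refine ext_inner_right ℂ fun k => ?_
  rw [hφi, ← ContinuousLinearMap.adjoint_inner_right (wordProd X α), ← hadj,
    ← inner_conj_symm, ← hin, ← hφi, inner_conj_symm]

lemma exists_vN (e : HilbertBasis (Word n) ℂ F) (S : Fin n → F →L[ℂ] F)
    (hS : ∀ (i : Fin n) (α : Word n), S i (e α) = e (FreeMonoid.of i * α))
    (X : Fin n → K →L[ℂ] K) (hX : inBall 1 X) :
    ∃ φ : (F →L[ℂ] F) →L[ℂ] (K →L[ℂ] K), (∀ T, ‖φ T‖ ≤ ‖T‖) ∧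
      (∀ α, φ (wordProd S α) = wordProd X α) ∧
      (∀ α, φ (adjoint (wordProd S α)) = adjoint (wordProd X α)) := by
  obtain ⟨J, W, hW⟩ := exists_poisson e S hS X (q := ‖∑ i, X i * adjoint (X i)‖) (norm_nonneg _)
    (by simpa [inBall] using hX) (row_bound X le_rfl)
  have hinter : ∀ α h j, W (adjoint (wordProd X α) h) j = adjoint (wordProd S α) (W h j) := by
    intro α
    induction α using word_induction with
    | h1 =>
      intro h j
      rw [wordProd_one, wordProd_one, ← ContinuousLinearMap.star_eq_adjoint, star_one,
        ← ContinuousLinearMap.star_eq_adjoint, star_one]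
      rfl
    | h2 i α ih =>
      intro h j
      rw [adj_cons, adj_cons, ih, hW]
  refine vN_abstract S X W (amp J) (amp_add J) (amp_smul J) (amp_norm_le J) (amp_inner J) ?_
  intro α h
  ext j
  rw [amp_apply, hinter]

end aux2

section aux3

variable {n : ℕ}
variable {F : Type} [NormedAddCommGroup F] [InnerProductSpace ℂ F] [CompleteSpace F]
variable {H : Type} [NormedAddCommGroup H] [InnerProductSpace ℂ H] [CompleteSpace H]

lemma exists_embed (hH : ¬ FiniteDimensional ℂ H) (e : HilbertBasis (Word n) ℂ F) :
    ∃ V : F →ₗᵢ[ℂ] H, True := by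
  obtain ⟨w, f, hf⟩ := exists_hilbertBasis ℂ H
  have hw : Infinite w := by
    by_contra hfin
    rw [not_infinite_iff_finite] at hfin
    haveI := Fintype.ofFinite w
    exact hH f.toOrthonormalBasis.toBasis.finiteDimensional_of_finite
  haveI : Countable (Word n) := inferInstanceAs (Countable (List (Fin n)))
  obtain ⟨g, hg⟩ := exists_injective_nat (Word n)
  let m : Word n → w := fun α => Infinite.natEmbedding w (g α)
  have hm : Function.Injective m := (Infinite.natEmbedding w).injective.comp hg
  have ho : Orthonormal ℂ (fun α => f (m α)) := f.orthonormal.comp m hm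
  exact ⟨ho.orthogonalFamily.linearIsometry.comp e.repr.toLinearIsometry, trivial⟩

lemma smul_inBall {X : Fin n → H →L[ℂ] H} (hX : inClosedBall 1 X) {r : ℝ} (h0 : 0 ≤ r)
    (h1 : r < 1) : inBall 1 (fun i => (r : ℂ) • X i) := by
  unfold inBall inClosedBall at *
  rw [norm_row_smul]
  have := norm_nonneg (∑ i, X i * adjoint (X i))
  nlinarith

lemma inBall_closed {X : Fin n → H →L[ℂ] H} (hX : inBall 1 X) : inClosedBall 1 X :=
  le_of_lt hX

lemma tendsto_smul_self (X : Fin n → H →L[ℂ] H) :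
    Tendsto (fun r : ℝ => (fun i => (r : ℂ) • X i)) (nhdsWithin 1 (Set.Ico (0 : ℝ) 1)) (nhds X) := by
  have hc : Continuous (fun r : ℝ => (fun i => (r : ℂ) • X i)) := by
    refine continuous_pi fun i => ?_
    exact (Complex.continuous_ofReal).smul continuous_const
  have := hc.tendsto 1
  simp only [Complex.ofReal_one, one_smul] at this
  exact this.mono_left nhdsWithin_le_nhds

lemma tendsto_smul_self' {X : Fin n → H →L[ℂ] H} (hX : inClosedBall 1 X) :
    Tendsto (fun r : ℝ => (fun i => (r : ℂ) • X i)) (nhdsWithin 1 (Set.Ico (0 : ℝ) 1))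
      (nhdsWithin X {X | inClosedBall 1 X}) := by
  refine tendsto_nhdsWithin_iff.2 ⟨tendsto_smul_self X, ?_⟩
  filter_upwards [self_mem_nhdsWithin] with r hr
  exact inBall_closed (smul_inBall hX hr.1 hr.2)

instance ico_neBot : (nhdsWithin 1 (Set.Ico (0 : ℝ) 1)).NeBot := by
  rw [← mem_closure_iff_nhdsWithin_neBot, closure_Ico (by norm_num)]
  simp

lemma forward (hH : ¬ FiniteDimensional ℂ H)
    (e : HilbertBasis (Word n) ℂ F)
    (S : Fin n → F →L[ℂ] F)
    (hS : ∀ (i : Fin n) (α : Word n), S i (e α) = e (FreeMonoid.of i * α))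
    (a b : Word n → ℂ) (ha : radCond 1 a) (hb : radCond 1 b)
    (u' : (Fin n → H →L[ℂ] H) → H →L[ℂ] H)
    (hu : ContinuousOn u' {X : Fin n → H →L[ℂ] H | inClosedBall 1 X})
    (hu2 : ∀ X : Fin n → H →L[ℂ] H, inBall 1 X → u' X = phOp a b X) :
    ∃ L : F →L[ℂ] F,
      Tendsto (fun r : ℝ => phOp (scaleCoef r a) (scaleCoef r b) S)
        (nhdsWithin 1 (Set.Ico (0 : ℝ) 1)) (nhds L) := by
  obtain ⟨V, -⟩ := exists_embed hH e
  set v : F →L[ℂ] H := V.toContinuousLinearMap with hv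
  have hvv : (adjoint v).comp v = ContinuousLinearMap.id ℂ F := by
    ext x
    refine ext_inner_right ℂ fun y => ?_
    rw [ContinuousLinearMap.comp_apply, ContinuousLinearMap.adjoint_inner_left]
    exact V.inner_map_map x y
  have hvv' : ∀ x, adjoint v (v x) = x := fun x => DFunLike.congr_fun hvv x
  let X : Fin n → H →L[ℂ] H := fun i => v.comp ((S i).comp (adjoint v))
  have hSb := S_inClosedBall e S hS
  have hX : inClosedBall 1 X := by
    have h1 : ∑ i, X i * adjoint (X i) =
        v.comp ((∑ i, S i * adjoint (S i)).comp (adjoint v)) := by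
      ext x
      simp only [X, _root_.sum_apply, ContinuousLinearMap.comp_apply, mul_apply_eq_comp,
        ContinuousLinearMap.adjoint_comp, ContinuousLinearMap.adjoint_adjoint, hvv', map_sum]
    have hW1 : ‖v‖ ≤ 1 := V.norm_toContinuousLinearMap_le
    have hW2 : ‖adjoint v‖ ≤ 1 := by
      rw [LinearIsometryEquiv.norm_map]; exact hW1
    unfold inClosedBall at hSb ⊢
    rw [h1]
    calc _ ≤ ‖v‖ * (‖∑ i, S i * adjoint (S i)‖ * ‖adjoint v‖) :=
          (opNorm_comp_le _ _).trans (by gcongr; exact opNorm_comp_le _ _)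
      _ ≤ 1 * (1 ^ 2 * 1) := by gcongr
      _ = 1 ^ 2 := by ring
  have hXw : ∀ α x, wordProd X α (v x) = v (wordProd S α x) := by
    intro α
    induction α using word_induction with
    | h1 => intro x; simp [wordProd_one]
    | h2 i α ih =>
      intro x
      rw [wordProd_cons, wordProd_cons, mul_apply_eq_comp, mul_apply_eq_comp, ih]
      simp [X, hvv']
  let φ : (H →L[ℂ] H) →L[ℂ] (F →L[ℂ] F) :=
    (ContinuousLinearMap.compL ℂ F H F (adjoint v)).comp
      ((ContinuousLinearMap.compL ℂ F H H).flip v)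
  have hφ : ∀ T, φ T = (adjoint v).comp (T.comp v) := fun T => rfl
  have h1 : ∀ α, φ (wordProd X α) = wordProd S α := by
    intro α
    ext x
    rw [hφ, ContinuousLinearMap.comp_apply, ContinuousLinearMap.comp_apply, hXw, hvv']
  have h2 : ∀ α, φ (adjoint (wordProd X α)) = adjoint (wordProd S α) := by
    intro α
    rw [← h1, hφ, hφ, ContinuousLinearMap.adjoint_comp, ContinuousLinearMap.adjoint_comp,
      ContinuousLinearMap.adjoint_adjoint, ContinuousLinearMap.comp_assoc]
  refine ⟨φ (u' X), ?_⟩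
  have ht : Tendsto (fun r : ℝ => φ (u' (fun i => (r : ℂ) • X i)))
      (nhdsWithin 1 (Set.Ico (0 : ℝ) 1)) (nhds (φ (u' X))) :=
    (φ.continuous.tendsto _).comp ((hu X hX).tendsto.comp (tendsto_smul_self' hX))
  refine ht.congr' ?_
  filter_upwards [self_mem_nhdsWithin] with r hr
  rw [hu2 _ (smul_inBall hX hr.1 hr.2), ← phOp_scale]
  exact map_phOp hX (good_scale ha hr.1 hr.2) (good_scale hb hr.1 hr.2) φ h1 h2

lemma vN_ineq (e : HilbertBasis (Word n) ℂ F)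
    (S : Fin n → F →L[ℂ] F)
    (hS : ∀ (i : Fin n) (α : Word n), S i (e α) = e (FreeMonoid.of i * α))
    {a b a' b' : Word n → ℂ} (ha : good a) (hb : good b) (ha' : good a') (hb' : good b')
    {X : Fin n → H →L[ℂ] H} (hX : inClosedBall 1 X) :
    dist (phOp a b X) (phOp a' b' X) ≤ dist (phOp a b S) (phOp a' b' S) := by
  have hSb := S_inClosedBall e S hS
  have t1 := (continuousOn_phOp ha hb X hX).tendsto.comp (tendsto_smul_self' hX)
  have t2 := (continuousOn_phOp ha' hb' X hX).tendsto.comp (tendsto_smul_self' hX)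
  refine le_of_tendsto (t1.dist t2) ?_
  filter_upwards [self_mem_nhdsWithin] with r hr
  obtain ⟨φ, hφ, h1, h2⟩ := exists_vN e S hS _ (smul_inBall hX hr.1 hr.2)
  simp only [Function.comp]
  rw [← map_phOp hSb ha hb φ h1 h2, ← map_phOp hSb ha' hb' φ h1 h2, dist_eq_norm, dist_eq_norm,
    ← map_sub]
  exact hφ _

lemma tendsto_scale {a b : Word n → ℂ} (ha : radCond 1 a) (hb : radCond 1 b)
    {X : Fin n → H →L[ℂ] H} (hX : inBall 1 X) :
    Tendsto (fun r : ℝ => phOp (scaleCoef r a) (scaleCoef r b) X)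
      (nhdsWithin 1 (Set.Ico (0 : ℝ) 1)) (nhds (phOp a b X)) := by
  set q := ‖∑ i, X i * adjoint (X i)‖ with hq
  have hq0 : 0 ≤ q := norm_nonneg _
  have hq1 : q < 1 := by simpa [inBall] using hX
  obtain ⟨s, hs0, hs1, hs⟩ : ∃ s : ℝ, 0 < s ∧ s < 1 ∧ q ≤ s ^ 2 := by
    refine ⟨(1 + q) / 2, by linarith, by linarith, ?_⟩
    nlinarith [sq_nonneg (1 - q)]
  let Y : Fin n → H →L[ℂ] H := fun i => ((s⁻¹ : ℝ) : ℂ) • X i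
  have hY : inClosedBall 1 Y := by
    unfold inClosedBall
    simp only [Y]
    rw [norm_row_smul, ← hq, inv_pow, inv_mul_le_iff₀ (by positivity)]
    linarith
  have hXY : X = fun i => (s : ℂ) • Y i := by
    funext i
    simp only [Y]
    rw [smul_smul, ← Complex.ofReal_mul, mul_inv_cancel₀ hs0.ne']
    simp
  have t := (continuousOn_phOp (good_scale ha hs0.le hs1) (good_scale hb hs0.le hs1) Y hY).tendsto.comp
    (tendsto_smul_self' hY)
  rw [phOp_scale, ← hXY] at t
  refine t.congr fun r => ?_
  simp only [Function.comp]
  rw [phOp_scale, phOp_scale]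
  congr 1
  rw [hXY]
  funext i
  simp only
  rw [smul_comm]

lemma backward (e : HilbertBasis (Word n) ℂ F)
    (S : Fin n → F →L[ℂ] F)
    (hS : ∀ (i : Fin n) (α : Word n), S i (e α) = e (FreeMonoid.of i * α))
    (a b : Word n → ℂ) (ha : radCond 1 a) (hb : radCond 1 b) (L : F →L[ℂ] F)
    (hL : Tendsto (fun r : ℝ => phOp (scaleCoef r a) (scaleCoef r b) S)
        (nhdsWithin 1 (Set.Ico (0 : ℝ) 1)) (nhds L)) :
    ∃ u' : (Fin n → H →L[ℂ] H) → H →L[ℂ] H,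
      ContinuousOn u' {X : Fin n → H →L[ℂ] H | inClosedBall 1 X} ∧
      ∀ X : Fin n → H →L[ℂ] H, inBall 1 X → u' X = phOp a b X := by
  set l := nhdsWithin 1 (Set.Ico (0 : ℝ) 1) with hl
  have hU : UniformCauchySeqOn (fun (r : ℝ) (X : Fin n → H →L[ℂ] H) =>
      phOp (scaleCoef r a) (scaleCoef r b) X) l {X | inClosedBall 1 X} := by
    intro u hu
    obtain ⟨ε, hε, hεu⟩ := Metric.mem_uniformity_dist.1 hu
    have hc := hL.cauchy_map
    have h1 := (Metric.cauchy_iff.1 hc).2 ε hε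
    obtain ⟨t, ht, htε⟩ := h1
    have h2 : ∀ᶠ r in l, phOp (scaleCoef r a) (scaleCoef r b) S ∈ t ∧ r ∈ Set.Ico (0:ℝ) 1 :=
      Filter.Eventually.and (Filter.mem_map.1 ht) self_mem_nhdsWithin
    filter_upwards [h2.prod_mk h2] with p hp X hX
    apply hεu
    refine lt_of_le_of_lt (vN_ineq e S hS ?_ ?_ ?_ ?_ hX) (htε _ hp.1.1 _ hp.2.1)
    · exact good_scale ha hp.1.2.1 hp.1.2.2
    · exact good_scale hb hp.1.2.1 hp.1.2.2
    · exact good_scale ha hp.2.2.1 hp.2.2.2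
    · exact good_scale hb hp.2.2.1 hp.2.2.2
  have hex : ∀ X : Fin n → H →L[ℂ] H, ∃ Z, inClosedBall 1 X →
      Tendsto (fun r : ℝ => phOp (scaleCoef r a) (scaleCoef r b) X) l (nhds Z) := by
    intro X
    by_cases hX : inClosedBall 1 X
    · have := hU.cauchy_map hX
      obtain ⟨Z, hZ⟩ := CompleteSpace.complete this
      exact ⟨Z, fun _ => hZ⟩
    · exact ⟨0, fun h => absurd h hX⟩
  choose u' hu' using hex
  refine ⟨u', ?_, fun X hX => tendsto_nhds_unique (hu' X (inBall_closed hX)) (tendsto_scale ha hb hX)⟩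
  have hT := hU.tendstoUniformlyOn_of_tendsto (fun X hX => hu' X hX)
  refine hT.continuousOn (Eventually.frequently ?_)
  filter_upwards [self_mem_nhdsWithin] with r hr
  exact continuousOn_phOp (good_scale ha hr.1 hr.2) (good_scale hb hr.1 hr.2)

end aux3

/-- Dirichlet extension problem: a free pluriharmonic function on the unit
ball of an infinite-dimensional Hilbert space `H` has a norm-continuous extension to the
closed unit ball iff its radial boundary function `u(rS₁, …, rSₙ)` converges in operator
norm as `r → 1⁻`. -/
theorem stmt_10 (n : ℕ) (hn : 1 ≤ n)
    (H : Type) [NormedAddCommGroup H] [InnerProductSpace ℂ H] [CompleteSpace H]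
    (hH : ¬ FiniteDimensional ℂ H)
    (F : Type) [NormedAddCommGroup F] [InnerProductSpace ℂ F] [CompleteSpace F]
    (e : HilbertBasis (Word n) ℂ F)
    (S : Fin n → F →L[ℂ] F)
    (hS : ∀ (i : Fin n) (α : Word n), S i (e α) = e (FreeMonoid.of i * α))
    (a b : Word n → ℂ) (ha : radCond 1 a) (hb : radCond 1 b) :
    (∃ u' : (Fin n → H →L[ℂ] H) → H →L[ℂ] H,
      ContinuousOn u' {X : Fin n → H →L[ℂ] H | inClosedBall 1 X} ∧
      ∀ X : Fin n → H →L[ℂ] H, inBall 1 X → u' X = phOp a b X) ↔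
    (∃ L : F →L[ℂ] F,
      Tendsto (fun r : ℝ => phOp (scaleCoef r a) (scaleCoef r b) S)
        (nhdsWithin 1 (Set.Ico (0 : ℝ) 1)) (nhds L)) := by
  constructor
  · rintro ⟨u, hu, hu2⟩
    exact forward hH e S hS a b ha hb u hu hu2
  · rintro ⟨L, hL⟩
    exact backward e S hS a b ha hb L hL

end
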